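/- The e-adjacency tensor allows the retrieval of the vertex degrees: for every original-vertex index i (that is, i corresponding to a vertex of Fin n under the embedding), the sum of r(t) over all tuples t : Fin k → Fin N with t(0) = i equals deg(v_i), the degree of the vertex v_i in the original hypergraph. -/

import Mathlib

open Finset

/-- Embedding of the original vertices `Fin n` into the extended vertex set `Fin (n + k - 1)`. -/
def emb (n k : ℕ) (hk : 1 ≤ k) (v : Fin n) : Fin (n + k - 1) :=
  ⟨(v : ℕ), by have := v.isLt; omega⟩

/-- The additional vertex `y_{j+1}` corresponds to the index `n + j` of `Fin (n + k - 1)`. -/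
def addIdx (n k : ℕ) (j : Fin (k - 1)) : Fin (n + k - 1) :=
  ⟨n + (j : ℕ), by have := j.isLt; omega⟩

/-- The set of additional indices `{n+s-1, ..., n+k-2}` used to fill a hyperedge `e`
of cardinality `s`. -/
def addSet (n k : ℕ) (e : Finset (Fin n)) : Finset (Fin (n + k - 1)) :=
  (Finset.univ.filter fun j : Fin (k - 1) => e.card - 1 ≤ (j : ℕ)).image (addIdx n k)

/-- The filled hyperedge `ê ⊆ Fin (n + k - 1)` of a hyperedge `e ⊆ Fin n`. -/
def filled (n k : ℕ) (hk : 1 ≤ k) (e : Finset (Fin n)) : Finset (Fin (n + k - 1)) :=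
  e.image (emb n k hk) ∪ addSet n k e

/-- The e-adjacency tensor of the hypergraph with hyperedge family `E`:
`r t = 1/(k-1)!` if `t` is injective with image a filled hyperedge, and `0` otherwise. -/
noncomputable def eAdj (n k : ℕ) (hk : 1 ≤ k) (E : Finset (Finset (Fin n))) :
    (Fin k → Fin (n + k - 1)) → ℝ := fun t =>
  if Function.Injective t ∧ ∃ e ∈ E, Finset.image t Finset.univ = filled n k hk e then
    1 / (Nat.factorial (k - 1)) else 0

/-- The degree of a vertex `v`: the number of hyperedges containing `v`. -/
def deg (n : ℕ) (E : Finset (Finset (Fin n))) (v : Fin n) : ℕ :=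
  (E.filter fun e => v ∈ e).card

/-- The tuple `(i, t 0, ..., t (m-2)) : Fin m → Fin N`. -/
def extend (m N : ℕ) (i : Fin N) (t : Fin (m - 1) → Fin N) : Fin m → Fin N :=
  fun j => if h : (j : ℕ) = 0 then i else t ⟨(j : ℕ) - 1, by have := j.isLt; omega⟩

/-- `(lam, x)` is an eigenpair of the order-`m`, dimension-`N` hypermatrix `T`. -/
def IsEigenpair (m N : ℕ) (T : (Fin m → Fin N) → ℝ) (lam : ℂ) (x : Fin N → ℂ) : Prop :=
  x ≠ 0 ∧ ∀ i : Fin N,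
    ∑ t : Fin (m - 1) → Fin N, (T (extend m N i t) : ℂ) * ∏ j : Fin (m - 1), x (t j)
      = lam * x i ^ (m - 1)


theorem emb_injective (n k : ℕ) (hk : 1 ≤ k) : Function.Injective (emb n k hk) := by
  intro v w h
  simpa [emb, Fin.ext_iff] using h

theorem addIdx_injective (n k : ℕ) : Function.Injective (addIdx n k) := by
  intro v w h
  simpa [addIdx, Fin.ext_iff] using h

theorem emb_ne_addIdx (n k : ℕ) (hk : 1 ≤ k) (v : Fin n) (j : Fin (k - 1)) :
    emb n k hk v ≠ addIdx n k j := by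
  intro h
  have h' : (v : ℕ) = n + j := congrArg Fin.val h
  have := v.isLt
  omega

theorem emb_mem_filled (n k : ℕ) (hk : 1 ≤ k) (e : Finset (Fin n)) (v : Fin n) :
    emb n k hk v ∈ filled n k hk e ↔ v ∈ e := by
  have hadd : emb n k hk v ∉ addSet n k e := by
    intro h
    obtain ⟨j, -, hj⟩ := Finset.mem_image.mp h
    exact emb_ne_addIdx n k hk v j hj.symm
  simp [filled, hadd, (emb_injective n k hk).eq_iff]

theorem filled_injective (n k : ℕ) (hk : 1 ≤ k) : Function.Injective (filled n k hk) := by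
  intro e f h
  ext v
  rw [← emb_mem_filled n k hk e, h, emb_mem_filled]

theorem card_filled (n k : ℕ) (hk : 1 ≤ k) (e : Finset (Fin n)) (he : e.Nonempty)
    (hek : e.card ≤ k) : (filled n k hk e).card = k := by
  have hdisj : Disjoint (e.image (emb n k hk)) (addSet n k e) := by
    rw [Finset.disjoint_left]
    intro x hx hx'
    obtain ⟨v, -, rfl⟩ := Finset.mem_image.mp hx
    obtain ⟨j, -, hj⟩ := Finset.mem_image.mp hx'
    exact emb_ne_addIdx n k hk v j hj.symm
  have hadd : (addSet n k e).card = k - 1 - (e.card - 1) := by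
    rw [addSet, Finset.card_image_of_injective _ (addIdx_injective n k)]
    have hsplit := Finset.card_filter_add_card_filter_not (s := (Finset.univ : Finset (Fin (k - 1))))
      (fun j => (j : ℕ) < e.card - 1)
    rw [Fin.card_filter_val_lt, Finset.card_univ, Fintype.card_fin] at hsplit
    simp only [not_lt] at hsplit
    omega
  have := he.card_pos
  rw [filled, Finset.card_union_of_disjoint hdisj, hadd,
    Finset.card_image_of_injective _ (emb_injective n k hk)]
  omega

/-- The number of enumerations of an `(m + 1)`-element set with prescribed first element. -/
theorem card_enumerations_with_head {α : Type*} [Fintype α] [DecidableEq α] (m : ℕ)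
    (S : Finset α) (hS : S.card = m + 1) (a : α) (ha : a ∈ S) :
    (Finset.univ.filter fun t : Fin (m + 1) → α =>
      t 0 = a ∧ Function.Injective t ∧ Finset.image t Finset.univ = S).card = m.factorial := by
  have hcard : Fintype.card (Fin m ↪ {x // x ∈ S.erase a}) = m.factorial := by
    rw [Fintype.card_embedding_eq, Fintype.card_coe, Finset.card_erase_of_mem ha, hS,
      Fintype.card_fin, Nat.add_sub_cancel, Nat.descFactorial_self]
  rw [← hcard, ← Finset.card_univ]
  symm
  refine Finset.card_bij (fun f _ => Fin.cons a fun j => (f j : α)) ?_ ?_ ?_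
  · intro f _
    have hinj : Function.Injective (Fin.cons a fun j => (f j : α) : Fin (m + 1) → α) := by
      rw [Fin.cons_injective_iff]
      refine ⟨?_, Subtype.val_injective.comp f.injective⟩
      rintro ⟨j, hj⟩
      exact (Finset.mem_erase.mp (f j).2).1 hj
    refine Finset.mem_filter.mpr ⟨Finset.mem_univ _, rfl, hinj, ?_⟩
    refine Finset.eq_of_subset_of_card_le ?_ ?_
    · intro x hx
      obtain ⟨j, -, rfl⟩ := Finset.mem_image.mp hx
      refine Fin.cases ha (fun j => ?_) j
      exact (Finset.mem_erase.mp (f j).2).2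
    · rw [Finset.card_image_of_injective _ hinj, hS, Finset.card_univ, Fintype.card_fin]
  · intro f _ g _ h
    ext j
    exact congrFun (Fin.cons_right_injective (α := fun _ => α) a h) j
  · intro t ht
    obtain ⟨-, h0, hinj, himg⟩ := Finset.mem_filter.mp ht
    refine ⟨⟨fun j => ⟨t j.succ, Finset.mem_erase.mpr ⟨?_, ?_⟩⟩, ?_⟩, Finset.mem_univ _, ?_⟩
    · rw [← h0]
      exact fun h => Fin.succ_ne_zero j (hinj h)
    · rw [← himg]
      exact Finset.mem_image_of_mem t (Finset.mem_univ _)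
    · intro j l h
      exact Fin.succ_injective _ (hinj (congrArg Subtype.val h))
    · subst h0
      exact Fin.cons_self_tail t

/-- Retrieval of vertex degrees from the e-adjacency tensor: for every original vertex `i`,
the sum of the entries `r t` over all tuples `t` whose first component is (the image of) `i`
equals the degree of `i` in the original hypergraph. -/
theorem eAdj_degree_retrieval (n k : ℕ) (hn : 1 ≤ n) (hk : 2 ≤ k)
    (E : Finset (Finset (Fin n)))
    (hE1 : ∀ e ∈ E, e.Nonempty) (hE2 : ∀ e ∈ E, e.card ≤ k) (i : Fin n) :
    ∑ t ∈ Finset.univ.filter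
        (fun t : Fin k → Fin (n + k - 1) => t ⟨0, by omega⟩ = emb n k (by omega) i),
      eAdj n k (by omega) E t = (deg n E i : ℝ) := by
  obtain ⟨m, rfl⟩ : ∃ m, k = m + 1 := ⟨k - 1, by omega⟩
  have hk' : 1 ≤ m + 1 := by omega
  have hsupp : (Finset.univ.filter fun t : Fin (m + 1) → Fin (n + (m + 1) - 1) =>
        t 0 = emb n (m + 1) hk' i ∧ Function.Injective t ∧
          ∃ e ∈ E, Finset.image t Finset.univ = filled n (m + 1) hk' e) =
      (E.filter fun e => i ∈ e).biUnion fun e => Finset.univ.filter fun t =>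
        t 0 = emb n (m + 1) hk' i ∧ Function.Injective t ∧
          Finset.image t Finset.univ = filled n (m + 1) hk' e := by
    ext t
    simp only [Finset.mem_filter, Finset.mem_univ, true_and, Finset.mem_biUnion]
    constructor
    · rintro ⟨h0, hinj, e, he, himg⟩
      refine ⟨e, ⟨he, ?_⟩, h0, hinj, himg⟩
      rw [← emb_mem_filled n (m + 1) hk', ← himg, ← h0]
      exact Finset.mem_image_of_mem t (Finset.mem_univ _)
    · rintro ⟨e, ⟨he, -⟩, h0, hinj, himg⟩
      exact ⟨h0, hinj, e, he, himg⟩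
  have hcount : (Finset.univ.filter fun t : Fin (m + 1) → Fin (n + (m + 1) - 1) =>
        t 0 = emb n (m + 1) hk' i ∧ Function.Injective t ∧
          ∃ e ∈ E, Finset.image t Finset.univ = filled n (m + 1) hk' e).card =
      deg n E i * m.factorial := by
    rw [hsupp, Finset.card_biUnion]
    · rw [deg, ← smul_eq_mul]
      refine Finset.sum_eq_card_nsmul fun e he => ?_
      obtain ⟨heE, hie⟩ := Finset.mem_filter.mp he
      exact card_enumerations_with_head m _
        (card_filled n (m + 1) hk' e (hE1 e heE) (hE2 e heE)) _
        ((emb_mem_filled n (m + 1) hk' e i).mpr hie)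
    · intro e _ f _ hef
      rw [Function.onFun, Finset.disjoint_left]
      intro t ht ht'
      simp only [Finset.mem_filter] at ht ht'
      exact hef (filled_injective n (m + 1) hk' (ht.2.2.2.symm.trans ht'.2.2.2))
  have hfact : (m.factorial : ℝ) ≠ 0 := Nat.cast_ne_zero.mpr m.factorial_ne_zero
  simp only [eAdj]
  rw [← Finset.sum_filter, Finset.filter_filter, Finset.sum_const]
  change (Finset.card (Finset.univ.filter fun t : Fin (m + 1) → Fin (n + (m + 1) - 1) =>
        t 0 = emb n (m + 1) hk' i ∧ Function.Injective t ∧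
          ∃ e ∈ E, Finset.image t Finset.univ = filled n (m + 1) hk' e)) •
            (1 / (m.factorial : ℝ)) = _
  rw [hcount, nsmul_eq_mul, Nat.cast_mul]
  field_simp
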